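/- Let (z_t) be functions produced by the buyer's pricing recursion for an American option with adapted ℝ²-valued payoff (ξ,ζ). Then for a pair (γ,δ) ∈ ℝ² the following are equivalent: (1) γ ≥ z_0(δ); (2) there exist a self-financing strategy (α,β) with (α_0,β_0) = (γ,δ) and a pure stopping time τ such that θ_τ(α_τ + ξ_τ, β_τ + ζ_τ) ≥ 0; (3) there is a buyer superhedging strategy (α,β) with (α_0,β_0) = (γ,δ). -/

import Mathlib

open MeasureTheory
open scoped Pointwise

noncomputable section

namespace RZ

variable {Ω : Type*} [Fintype Ω]

/-- `ω` and `ω'` lie in the same atom of the σ-field `m`. -/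
def sameAtom (m : MeasurableSpace Ω) (ω ω' : Ω) : Prop :=
  ∀ A : Set Ω, MeasurableSet[m] A → (ω ∈ A ↔ ω' ∈ A)

/-- Elementary conditional expectation w.r.t. a σ-field on a finite space:
at `ω` it is the `P`-average of `f` over the atom of `ω`. -/
def condExp (m : MeasurableSpace Ω) (P : Ω → ℝ) (f : Ω → ℝ) (ω : Ω) : ℝ :=
  (∑ ω' : Ω, Set.indicator {ω'' | sameAtom m ω ω''} (fun ω'' => P ω'' * f ω'') ω') /
  (∑ ω' : Ω, Set.indicator {ω'' | sameAtom m ω ω''} P ω')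

/-- Expectation under `P`. -/
def expect (P : Ω → ℝ) (f : Ω → ℝ) : ℝ := ∑ ω : Ω, P ω * f ω

/-- Discrete market model with proportional transaction costs. -/
structure Market (Ω : Type*) [Fintype Ω] where
  T : ℕ
  T_pos : 0 < T
  F : ℕ → MeasurableSpace Ω
  F_mono : ∀ ⦃s t : ℕ⦄, s ≤ t → F s ≤ F t
  F_zero : F 0 = ⊥
  F_top : F T = ⊤
  Q : Ω → ℝ
  Q_pos : ∀ ω, 0 < Q ω
  Q_sum : ∑ ω, Q ω = 1
  Sb : ℕ → Ω → ℝ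
  Sa : ℕ → Ω → ℝ
  Sb_pos : ∀ t ω, t ≤ T → 0 < Sb t ω
  Sb_le_Sa : ∀ t ω, t ≤ T → Sb t ω ≤ Sa t ω
  Sb_adapted : ∀ t, t ≤ T → Measurable[F t] (Sb t)
  Sa_adapted : ∀ t, t ≤ T → Measurable[F t] (Sa t)

variable (M : Market Ω)

/-- Liquidation value θ_t(γ, δ) in scenario ω, for a cash position γ and stock position δ. -/
def liq (t : ℕ) (ω : Ω) (γ δ : ℝ) : ℝ :=
  γ + M.Sb t ω * max δ 0 - M.Sa t ω * max (-δ) 0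

/-- An adapted (real-valued) process. -/
def IsAdapted (X : ℕ → Ω → ℝ) : Prop := ∀ t, t ≤ M.T → Measurable[M.F t] (X t)

/-- An adapted ℝ²-valued payoff process. -/
def AdaptedPair (ξ ζ : ℕ → Ω → ℝ) : Prop := IsAdapted M ξ ∧ IsAdapted M ζ

/-- Self-financing strategy. -/
def SelfFinancing (α β : ℕ → Ω → ℝ) : Prop :=
  Measurable[M.F 0] (α 0) ∧ Measurable[M.F 0] (β 0) ∧
  (∀ t, t < M.T → Measurable[M.F t] (α (t + 1)) ∧ Measurable[M.F t] (β (t + 1))) ∧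
  (∀ t, t < M.T → ∀ ω, 0 ≤ liq M t ω (α t ω - α (t + 1) ω) (β t ω - β (t + 1) ω))

/-- Pure stopping time with values in {0,...,T}. -/
def IsStop (τ : Ω → ℕ) : Prop :=
  (∀ ω, τ ω ≤ M.T) ∧ ∀ t : ℕ, MeasurableSet[M.F t] {ω | τ ω = t}

/-- Seller superhedging strategy. -/
def SellerHedge (ξ ζ α β : ℕ → Ω → ℝ) : Prop :=
  SelfFinancing M α β ∧
  ∀ τ, IsStop M τ → ∀ ω,
    0 ≤ liq M (τ ω) ω (α (τ ω) ω - ξ (τ ω) ω) (β (τ ω) ω - ζ (τ ω) ω)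

/-- Buyer superhedging strategy. -/
def BuyerHedge (ξ ζ α β : ℕ → Ω → ℝ) : Prop :=
  SelfFinancing M α β ∧
  ∃ τ, IsStop M τ ∧ ∀ ω,
    0 ≤ liq M (τ ω) ω (α (τ ω) ω + ξ (τ ω) ω) (β (τ ω) ω + ζ (τ ω) ω)

/-- Seller's (ask) price: infimum of the initial costs of seller superhedging strategies. -/
def askPrice (ξ ζ : ℕ → Ω → ℝ) : ℝ :=
  sInf {x | ∃ α β, SellerHedge M ξ ζ α β ∧ ∀ ω, x = -liq M 0 ω (-α 0 ω) (-β 0 ω)}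

/-- Buyer's (bid) price: supremum of the amounts raised by buyer superhedging strategies. -/
def bidPrice (ξ ζ : ℕ → Ω → ℝ) : ℝ :=
  sSup {x | ∃ α β, BuyerHedge M ξ ζ α β ∧ ∀ ω, x = liq M 0 ω (-α 0 ω) (-β 0 ω)}

/-- Mixed stopping time. -/
def IsMixedStop (χ : ℕ → Ω → ℝ) : Prop :=
  (∀ t, t ≤ M.T → Measurable[M.F t] (χ t)) ∧ (∀ t ω, 0 ≤ χ t ω) ∧
  ∀ ω, ∑ t ∈ Finset.range (M.T + 1), χ t ω = 1

/-- χ*_t = Σ_{s=t}^T χ_s  (so χ*_{T+1} = 0). -/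
def chiStar (χ : ℕ → Ω → ℝ) (t : ℕ) (ω : Ω) : ℝ := ∑ s ∈ Finset.Icc t M.T, χ s ω

/-- Z^{χ*}_t = Σ_{s=t}^T χ_s Z_s  (so Z^{χ*}_{T+1} = 0). -/
def starVal (χ Z : ℕ → Ω → ℝ) (t : ℕ) (ω : Ω) : ℝ :=
  ∑ s ∈ Finset.Icc t M.T, χ s ω * Z s ω

/-- Z_χ = Σ_{t=0}^T χ_t Z_t. -/
def mixVal (χ Z : ℕ → Ω → ℝ) (ω : Ω) : ℝ :=
  ∑ t ∈ Finset.range (M.T + 1), χ t ω * Z t ω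

/-- Membership in the family barP(χ). -/
def memBarP (χ : ℕ → Ω → ℝ) (P : Ω → ℝ) (S : ℕ → Ω → ℝ) : Prop :=
  (∀ ω, 0 ≤ P ω) ∧ (∑ ω, P ω) = 1 ∧ IsAdapted M S ∧
  (∀ t ω, t ≤ M.T → M.Sb t ω ≤ S t ω ∧ S t ω ≤ M.Sa t ω) ∧
  (∀ t, t ≤ M.T → ∀ ω, 0 < P ω →
    chiStar M χ (t + 1) ω * M.Sb t ω ≤ condExp (M.F t) P (starVal M χ S (t + 1)) ω ∧
    condExp (M.F t) P (starVal M χ S (t + 1)) ω ≤ chiStar M χ (t + 1) ω * M.Sa t ω)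

/-- Membership in the family P(χ): barP(χ) with P equivalent to Q. -/
def memP (χ : ℕ → Ω → ℝ) (P : Ω → ℝ) (S : ℕ → Ω → ℝ) : Prop :=
  memBarP M χ P S ∧ ∀ ω, 0 < P ω

/-- The mixed stopping time χ^τ associated with a pure stopping time τ. -/
def pureChi (τ : Ω → ℕ) : ℕ → Ω → ℝ := fun t ω => if τ ω = t then 1 else 0

/-- Arbitrage-free: there is an equivalent probability measure and a martingale
between the bid and ask prices. -/
def ArbitrageFree : Prop :=
  ∃ (P : Ω → ℝ) (S : ℕ → Ω → ℝ),
    (∀ ω, 0 < P ω) ∧ (∑ ω, P ω) = 1 ∧ IsAdapted M S ∧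
    (∀ t ω, t ≤ M.T → M.Sb t ω ≤ S t ω ∧ S t ω ≤ M.Sa t ω) ∧
    (∀ t, t < M.T → ∀ ω, 0 < P ω → condExp (M.F t) P (S (t + 1)) ω = S t ω)

/-- Epigraph of a function ℝ → ℝ, as a subset of ℝ² (first coordinate dominates). -/
def epi (f : ℝ → ℝ) : Set (ℝ × ℝ) := {p | f p.2 ≤ p.1}

/-- The function h_{[b,a]}(y) = a y⁻ − b y⁺. -/
def hfun (b a : ℝ) (y : ℝ) : ℝ := a * max (-y) 0 - b * max y 0

/-- Seller's payoff function u_t(y) = ξ_t + (y − ζ_t)⁻ S^a_t − (y − ζ_t)⁺ S^b_t. -/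
def uSell (ξ ζ : ℕ → Ω → ℝ) (t : ℕ) (ω : Ω) (y : ℝ) : ℝ :=
  ξ t ω + M.Sa t ω * max (ζ t ω - y) 0 - M.Sb t ω * max (y - ζ t ω) 0

/-- Buyer's payoff function u_t(y) = −ξ_t + (y + ζ_t)⁻ S^a_t − (y + ζ_t)⁺ S^b_t. -/
def uBuy (ξ ζ : ℕ → Ω → ℝ) (t : ℕ) (ω : Ω) (y : ℝ) : ℝ :=
  -ξ t ω + M.Sa t ω * max (-(y + ζ t ω)) 0 - M.Sb t ω * max (y + ζ t ω) 0

/-- The seller's pricing recursion: one function per atom,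
`z_T = u_T` and `epi z_{t-1} = epi u_{t-1} ∩ (epi h + ⋂_{succ} epi z_t)`. -/
def SellerRec (ξ ζ : ℕ → Ω → ℝ) (z : ℕ → Ω → ℝ → ℝ) : Prop :=
  (∀ t ω ω', t ≤ M.T → sameAtom (M.F t) ω ω' → z t ω = z t ω') ∧
  (∀ ω, z M.T ω = uSell M ξ ζ M.T ω) ∧
  (∀ t ω, t < M.T →
    epi (z t ω) = epi (uSell M ξ ζ t ω) ∩
      (epi (hfun (M.Sb t ω) (M.Sa t ω)) +
        ⋂ ω' ∈ {ω'' | sameAtom (M.F t) ω ω''}, epi (z (t + 1) ω')))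

/-- The buyer's pricing recursion: one function per atom,
`z_T = u_T` and `epi z_{t-1} = epi u_{t-1} ∪ (epi h + ⋂_{succ} epi z_t)`. -/
def BuyerRec (ξ ζ : ℕ → Ω → ℝ) (z : ℕ → Ω → ℝ → ℝ) : Prop :=
  (∀ t ω ω', t ≤ M.T → sameAtom (M.F t) ω ω' → z t ω = z t ω') ∧
  (∀ ω, z M.T ω = uBuy M ξ ζ M.T ω) ∧
  (∀ t ω, t < M.T →
    epi (z t ω) = epi (uBuy M ξ ζ t ω) ∪
      (epi (hfun (M.Sb t ω) (M.Sa t ω)) +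
        ⋂ ω' ∈ {ω'' | sameAtom (M.F t) ω ω''}, epi (z (t + 1) ω')))

theorem sameAtom.symm {Ω : Type*} {m : MeasurableSpace Ω} {ω ω' : Ω} (h : sameAtom m ω ω') :
    sameAtom m ω' ω :=
  fun A hA => (h A hA).symm

theorem sameAtom.mono {Ω : Type*} {m m' : MeasurableSpace Ω} (hm : m ≤ m') {ω ω' : Ω}
    (h : sameAtom m' ω ω') : sameAtom m ω ω' :=
  fun A hA => h A (hm A hA)

theorem sameAtom.trans {Ω : Type*} {m : MeasurableSpace Ω} {ω ω' ω'' : Ω}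
    (h : sameAtom m ω ω') (h' : sameAtom m ω' ω'') : sameAtom m ω ω'' :=
  fun A hA => (h A hA).trans (h' A hA)

theorem sameAtom.eq_of_measurable {Ω E : Type*} [MeasurableSpace E] [MeasurableSingletonClass E]
    {m : MeasurableSpace Ω} {f : Ω → E} (hf : Measurable[m] f) {ω ω' : Ω}
    (h : sameAtom m ω ω') : f ω = f ω' :=
  ((h _ (hf (measurableSet_singleton (f ω)))).1 rfl).symm

theorem measurableSet_of_sameAtom {Ω : Type*} [Finite Ω] {m : MeasurableSpace Ω} {A : Set Ω}
    (hA : ∀ ω ω', sameAtom m ω ω' → ω ∈ A → ω' ∈ A) : MeasurableSet[m] A := by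
  have hA' : A = ⋃ ω ∈ A, measurableAtom ω := by
    ext x
    simp only [Set.mem_iUnion, exists_prop]
    refine ⟨fun hx => ⟨x, hx, mem_measurableAtom_self x⟩, ?_⟩
    rintro ⟨ω, hω, hx⟩
    refine hA ω x (fun B hB => ?_) hω
    have key : ∀ C : Set Ω, MeasurableSet[m] C → ω ∈ C → x ∈ C := fun C hC hωC =>
      measurableAtom_subset hC hωC hx
    exact ⟨key B hB, fun hxB => by_contra fun hωB => key Bᶜ hB.compl hωB hxB⟩
  rw [hA']
  exact MeasurableSet.biUnion A.to_countable fun ω _ =>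
    MeasurableSet.measurableAtom_of_countable ω

theorem measurable_of_sameAtom {Ω E : Type*} [Finite Ω] [MeasurableSpace E]
    {m : MeasurableSpace Ω} {f : Ω → E} (hf : ∀ ω ω', sameAtom m ω ω' → f ω = f ω') :
    Measurable[m] f :=
  fun B _ => measurableSet_of_sameAtom fun ω ω' h hω => by
    rwa [Set.mem_preimage, ← hf ω ω' h]

theorem mem_epi_hfun_iff (t : ℕ) (ω : Ω) (x y : ℝ) :
    (x, y) ∈ epi (hfun (M.Sb t ω) (M.Sa t ω)) ↔ 0 ≤ liq M t ω x y := by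
  simp only [epi, hfun, liq, Set.mem_ofPred_eq]
  constructor <;> intro h <;> linarith

theorem mem_epi_uBuy_iff (ξ ζ : ℕ → Ω → ℝ) (t : ℕ) (ω : Ω) (x y : ℝ) :
    (x, y) ∈ epi (uBuy M ξ ζ t ω) ↔ 0 ≤ liq M t ω (x + ξ t ω) (y + ζ t ω) := by
  simp only [epi, uBuy, liq, Set.mem_ofPred_eq]
  constructor <;> intro h <;> linarith

variable {M}

theorem IsStop.eq_of_sameAtom {τ : Ω → ℕ} (hτ : IsStop M τ) {t : ℕ} {ω ω' : Ω}
    (h : sameAtom (M.F t) ω ω') (hle : τ ω ≤ t) : τ ω' = τ ω :=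
  (h.mono (M.F_mono hle) _ (hτ.2 (τ ω))).1 rfl

/-- A strategy that reaches solvency after exercise at `τ` stays in the epigraphs of the
recursion up to time `τ`. -/
theorem BuyerRec.mem_epi_of_le_stop {ξ ζ : ℕ → Ω → ℝ} {z : ℕ → Ω → ℝ → ℝ}
    (hz : BuyerRec M ξ ζ z) {α β : ℕ → Ω → ℝ} {τ : Ω → ℕ} (hsf : SelfFinancing M α β)
    (hτ : IsStop M τ)
    (hsolv : ∀ ω, 0 ≤ liq M (τ ω) ω (α (τ ω) ω + ξ (τ ω) ω) (β (τ ω) ω + ζ (τ ω) ω))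
    {t : ℕ} (ht : t ≤ M.T) : ∀ ω, t ≤ τ ω → (α t ω, β t ω) ∈ epi (z t ω) := by
  induction ht using Nat.decreasingInduction with
  | self =>
    intro ω hω
    rw [hz.2.1 ω, mem_epi_uBuy_iff]
    simpa only [le_antisymm (hτ.1 ω) hω] using hsolv ω
  | of_succ t ht ih =>
    intro ω hω
    rw [hz.2.2 t ω ht]
    rcases hω.eq_or_lt with heq | hlt
    · left
      rw [mem_epi_uBuy_iff]
      simpa only [← heq] using hsolv ω
    · right
      obtain ⟨hα, hβ⟩ := hsf.2.2.1 t ht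
      refine Set.mem_add.2 ⟨(α t ω - α (t + 1) ω, β t ω - β (t + 1) ω),
        (mem_epi_hfun_iff M t ω _ _).2 (hsf.2.2.2 t ht ω), (α (t + 1) ω, β (t + 1) ω), ?_,
        by simp⟩
      refine Set.mem_iInter₂.2 fun ω' (h : sameAtom (M.F t) ω ω') => ?_
      rw [h.eq_of_measurable hα, h.eq_of_measurable hβ]
      refine ih ω' (Nat.succ_le_of_lt (lt_of_not_ge fun hle => ?_))
      have := hτ.eq_of_sameAtom h.symm hle
      omega

variable (M)

/-- The portfolios that are affordable from `p` at time `t` and lie in every epigraph of the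
recursion at the successors of the atom of `ω`. -/
def rebalanceSet (z : ℕ → Ω → ℝ → ℝ) (t : ℕ) (ω : Ω) (p : ℝ × ℝ) : Set (ℝ × ℝ) :=
  {q | p - q ∈ epi (hfun (M.Sb t ω) (M.Sa t ω)) ∧
    ∀ ω', sameAtom (M.F t) ω ω' → q ∈ epi (z (t + 1) ω')}

open Classical in
/-- A chosen element of `A`, or the default value `p` if `A` is empty. -/
def chooseOr {E : Type*} (A : Set E) (p : E) : E :=
  if h : A.Nonempty then h.some else p

/-- The portfolio process started at `p` that moves into `rebalanceSet` whenever possible and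
is kept unchanged otherwise. -/
def hedge (z : ℕ → Ω → ℝ → ℝ) (p : ℝ × ℝ) : ℕ → Ω → ℝ × ℝ
  | 0, _ => p
  | t + 1, ω => chooseOr (rebalanceSet M z t ω (hedge z p t ω)) (hedge z p t ω)

variable {M}

theorem hedge_succ (z : ℕ → Ω → ℝ → ℝ) (p : ℝ × ℝ) (t : ℕ) (ω : Ω) :
    hedge M z p (t + 1) ω =
      chooseOr (rebalanceSet M z t ω (hedge M z p t ω)) (hedge M z p t ω) :=
  rfl

theorem rebalanceSet_congr (z : ℕ → Ω → ℝ → ℝ) {t : ℕ} (ht : t ≤ M.T) {ω ω' : Ω}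
    (h : sameAtom (M.F t) ω ω') : rebalanceSet M z t ω = rebalanceSet M z t ω' := by
  funext p
  unfold rebalanceSet
  rw [h.eq_of_measurable (M.Sb_adapted t ht), h.eq_of_measurable (M.Sa_adapted t ht)]
  ext q
  exact and_congr_right fun _ =>
    ⟨fun H ω'' h' => H ω'' (h.trans h'), fun H ω'' h' => H ω'' (h.symm.trans h')⟩

theorem hedge_succ_mem {z : ℕ → Ω → ℝ → ℝ} {p : ℝ × ℝ} {t : ℕ} {ω : Ω}
    (h : (rebalanceSet M z t ω (hedge M z p t ω)).Nonempty) :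
    hedge M z p (t + 1) ω ∈ rebalanceSet M z t ω (hedge M z p t ω) := by
  rw [hedge_succ, chooseOr, dif_pos h]
  exact h.some_mem

theorem hedge_sub_succ_mem (z : ℕ → Ω → ℝ → ℝ) (p : ℝ × ℝ) (t : ℕ) (ω : Ω) :
    hedge M z p t ω - hedge M z p (t + 1) ω ∈ epi (hfun (M.Sb t ω) (M.Sa t ω)) := by
  by_cases h : (rebalanceSet M z t ω (hedge M z p t ω)).Nonempty
  · exact (hedge_succ_mem h).1
  · rw [hedge_succ, chooseOr, dif_neg h]
    simp [epi, hfun]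

theorem hedge_succ_congr (z : ℕ → Ω → ℝ → ℝ) (p : ℝ × ℝ) :
    ∀ {t : ℕ}, t ≤ M.T → ∀ {ω ω' : Ω}, sameAtom (M.F t) ω ω' →
      hedge M z p t ω = hedge M z p t ω' ∧ hedge M z p (t + 1) ω = hedge M z p (t + 1) ω' := by
  intro t
  induction t with
  | zero =>
    intro ht ω ω' h
    refine ⟨rfl, ?_⟩
    simp only [hedge, rebalanceSet_congr z ht h]
  | succ t ih =>
    intro ht ω ω' h
    have heq := (ih (by omega) (h.mono (M.F_mono t.le_succ))).2
    refine ⟨heq, ?_⟩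
    rw [hedge_succ z p (t + 1) ω, hedge_succ z p (t + 1) ω', rebalanceSet_congr z ht h, heq]

theorem selfFinancing_hedge (z : ℕ → Ω → ℝ → ℝ) (p : ℝ × ℝ) :
    SelfFinancing M (fun t ω => (hedge M z p t ω).1) (fun t ω => (hedge M z p t ω).2) := by
  refine ⟨measurable_of_sameAtom fun _ _ _ => rfl, measurable_of_sameAtom fun _ _ _ => rfl,
    fun t ht => ⟨?_, ?_⟩, fun t ht ω => ?_⟩
  · exact measurable_of_sameAtom fun ω ω' h =>
      congrArg Prod.fst (hedge_succ_congr z p ht.le h).2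
  · exact measurable_of_sameAtom fun ω ω' h =>
      congrArg Prod.snd (hedge_succ_congr z p ht.le h).2
  · exact (mem_epi_hfun_iff M t ω _ _).1 (hedge_sub_succ_mem z p t ω)

theorem BuyerRec.hedge_mem_epi {ξ ζ : ℕ → Ω → ℝ} {z : ℕ → Ω → ℝ → ℝ} (hz : BuyerRec M ξ ζ z)
    {p : ℝ × ℝ} {ω : Ω} (hp : p ∈ epi (z 0 ω)) {t : ℕ} (ht : t ≤ M.T)
    (hs : ∀ s < t, hedge M z p s ω ∉ epi (uBuy M ξ ζ s ω)) :
    hedge M z p t ω ∈ epi (z t ω) := by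
  induction t with
  | zero => exact hp
  | succ t ih =>
    have hmem := ih (by omega) fun s hst => hs s (by omega)
    rw [hz.2.2 t ω (by omega)] at hmem
    obtain ⟨q, hq, r, hr, hqr⟩ := Set.mem_add.1 (hmem.resolve_left (hs t t.lt_succ_self))
    have hne : (rebalanceSet M z t ω (hedge M z p t ω)).Nonempty := by
      refine ⟨r, ?_, fun ω' h => Set.mem_iInter₂.1 hr ω' h⟩
      rwa [← hqr, add_sub_cancel_right]
    exact (hedge_succ_mem hne).2 ω fun _ _ => Iff.rfl

theorem BuyerRec.exists_hedge_mem_epi_uBuy {ξ ζ : ℕ → Ω → ℝ} {z : ℕ → Ω → ℝ → ℝ}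
    (hz : BuyerRec M ξ ζ z) {p : ℝ × ℝ} {ω : Ω} (hp : p ∈ epi (z 0 ω)) :
    ∃ t, t ≤ M.T ∧ hedge M z p t ω ∈ epi (uBuy M ξ ζ t ω) := by
  by_contra! H
  refine H M.T le_rfl ?_
  rw [← hz.2.1 ω]
  exact hz.hedge_mem_epi hp le_rfl fun s hs => H s hs.le

theorem uBuy_congr {ξ ζ : ℕ → Ω → ℝ} (hpay : AdaptedPair M ξ ζ) {t : ℕ} (ht : t ≤ M.T)
    {ω ω' : Ω} (h : sameAtom (M.F t) ω ω') : uBuy M ξ ζ t ω = uBuy M ξ ζ t ω' := by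
  funext y
  simp only [uBuy, h.eq_of_measurable (hpay.1 t ht), h.eq_of_measurable (hpay.2 t ht),
    h.eq_of_measurable (M.Sb_adapted t ht), h.eq_of_measurable (M.Sa_adapted t ht)]

open Classical in
/-- The first time at which an adapted condition holds is a stopping time. -/
theorem isStop_find {P : ℕ → Ω → Prop} (hP : ∀ ω, ∃ t, t ≤ M.T ∧ P t ω)
    (hadapt : ∀ t ≤ M.T, ∀ ω ω', sameAtom (M.F t) ω ω' → P t ω → P t ω') :
    IsStop M fun ω => Nat.find (hP ω) := by
  have hle : ∀ ω, Nat.find (hP ω) ≤ M.T := fun ω => (Nat.find_spec (hP ω)).1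
  refine ⟨hle, fun t => measurableSet_of_sameAtom fun ω ω' h hω => ?_⟩
  have ht : t ≤ M.T := hω ▸ hle ω
  simp only [Set.mem_ofPred_eq, Nat.find_eq_iff] at hω ⊢
  exact ⟨⟨ht, hadapt t ht ω ω' h hω.1.2⟩, fun s hst hs => hω.2 s hst
    ⟨hs.1, hadapt s hs.1 ω' ω (h.symm.mono (M.F_mono hst.le)) hs.2⟩⟩

theorem BuyerRec.exists_buyer_strategy {ξ ζ : ℕ → Ω → ℝ} {z : ℕ → Ω → ℝ → ℝ}
    (hpay : AdaptedPair M ξ ζ) (hz : BuyerRec M ξ ζ z) {γ δ : ℝ} (hγ : ∀ ω, z 0 ω δ ≤ γ) :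
    ∃ α β τ, SelfFinancing M α β ∧ IsStop M τ ∧ (∀ ω, α 0 ω = γ ∧ β 0 ω = δ) ∧
      ∀ ω, 0 ≤ liq M (τ ω) ω (α (τ ω) ω + ξ (τ ω) ω) (β (τ ω) ω + ζ (τ ω) ω) := by
  classical
  have hex : ∀ ω, ∃ t, t ≤ M.T ∧ hedge M z (γ, δ) t ω ∈ epi (uBuy M ξ ζ t ω) :=
    fun ω => hz.exists_hedge_mem_epi_uBuy (hγ ω)
  refine ⟨_, _, fun ω => Nat.find (hex ω), selfFinancing_hedge z (γ, δ),
    isStop_find hex fun t ht ω ω' h hω => ?_, fun ω => ⟨rfl, rfl⟩, fun ω => ?_⟩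
  · rwa [← uBuy_congr hpay ht h, ← (hedge_succ_congr z (γ, δ) ht h).1]
  · exact (mem_epi_uBuy_iff M ξ ζ _ ω _ _).1 (Nat.find_spec (hex ω)).2

variable (M)

/-- Lemma (buyer's hedging characterisation): γ ≥ z₀(δ) iff (γ,δ) starts a
self-financing strategy together with a pure stopping time at which the buyer is
solvent after exercise, iff (γ,δ) starts a buyer superhedging strategy. -/
theorem buyer_hedging_characterization (ξ ζ : ℕ → Ω → ℝ) (hpay : AdaptedPair M ξ ζ)
    (z : ℕ → Ω → ℝ → ℝ) (hz : BuyerRec M ξ ζ z) (γ δ : ℝ) :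
    ((∀ ω, z 0 ω δ ≤ γ) ↔
      ∃ α β τ, SelfFinancing M α β ∧ IsStop M τ ∧ (∀ ω, α 0 ω = γ ∧ β 0 ω = δ) ∧
        ∀ ω, 0 ≤ liq M (τ ω) ω (α (τ ω) ω + ξ (τ ω) ω) (β (τ ω) ω + ζ (τ ω) ω)) ∧
    ((∀ ω, z 0 ω δ ≤ γ) ↔
      ∃ α β, BuyerHedge M ξ ζ α β ∧ ∀ ω, α 0 ω = γ ∧ β 0 ω = δ) := by
  have hiff : (∀ ω, z 0 ω δ ≤ γ) ↔
      ∃ α β τ, SelfFinancing M α β ∧ IsStop M τ ∧ (∀ ω, α 0 ω = γ ∧ β 0 ω = δ) ∧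
        ∀ ω, 0 ≤ liq M (τ ω) ω (α (τ ω) ω + ξ (τ ω) ω) (β (τ ω) ω + ζ (τ ω) ω) := by
    refine ⟨hz.exists_buyer_strategy hpay, ?_⟩
    rintro ⟨α, β, τ, hsf, hτ, h0, hsolv⟩ ω
    have hmem := hz.mem_epi_of_le_stop hsf hτ hsolv M.T.zero_le ω (τ ω).zero_le
    rwa [(h0 ω).1, (h0 ω).2] at hmem
  refine ⟨hiff, hiff.trans ⟨?_, ?_⟩⟩
  · rintro ⟨α, β, τ, hsf, hτ, h0, hsolv⟩
    exact ⟨α, β, ⟨hsf, τ, hτ, hsolv⟩, h0⟩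
  · rintro ⟨α, β, ⟨hsf, τ, hτ, hsolv⟩, h0⟩
    exact ⟨α, β, τ, hsf, hτ, h0, hsolv⟩

end RZ
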